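/- The classical family algebra is closed under the noncommutative Poisson bracket: if 𝒜 and ℬ lie in C_τ(𝔤), then {𝒜,ℬ} lies in C_τ(𝔤). -/

import Mathlib

open TensorProduct MvPolynomial

noncomputable section

/-- The bilinear map `(a, b) ↦ u * D₁ a * D₂ b` on polynomials. -/
def bil {n : ℕ} (u : MvPolynomial (Fin n) ℂ)
    (D₁ D₂ : MvPolynomial (Fin n) ℂ →ₗ[ℂ] MvPolynomial (Fin n) ℂ) :
    MvPolynomial (Fin n) ℂ →ₗ[ℂ] MvPolynomial (Fin n) ℂ →ₗ[ℂ] MvPolynomial (Fin n) ℂ :=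
  (((LinearMap.mul ℂ (MvPolynomial (Fin n) ℂ)).comp
      ((LinearMap.mulLeft ℂ u).comp D₁)).compl₂ D₂)

/-- The Poisson bracket `{a,b} = Σ c^k_{ij} X_k (∂^i a)(∂^j b)` on `S(𝔤)`. -/
def Pb {n : ℕ} (c : Fin n → Fin n → Fin n → ℂ) :
    MvPolynomial (Fin n) ℂ →ₗ[ℂ] MvPolynomial (Fin n) ℂ →ₗ[ℂ] MvPolynomial (Fin n) ℂ :=
  ∑ i, ∑ j, ∑ k, c k i j •
    bil (X k) (pderiv i).toLinearMap (pderiv j).toLinearMap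

/-- The noncommutative Poisson bracket on `End V ⊗ S(𝔤)`:
`{A ⊗ a, B ⊗ b} = AB ⊗ {a,b}`. -/
def Pnc {n : ℕ} (c : Fin n → Fin n → Fin n → ℂ) (V : Type*) [AddCommGroup V] [Module ℂ V] :
    (Module.End ℂ V ⊗[ℂ] MvPolynomial (Fin n) ℂ) →ₗ[ℂ]
      (Module.End ℂ V ⊗[ℂ] MvPolynomial (Fin n) ℂ) →ₗ[ℂ]
        (Module.End ℂ V ⊗[ℂ] MvPolynomial (Fin n) ℂ) :=
  TensorProduct.map₂ (LinearMap.mul ℂ (Module.End ℂ V)) (Pb c)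

/-- `A ↦ [f, A]` on `End V`. -/
def adE {V : Type*} [AddCommGroup V] [Module ℂ V] (f : Module.End ℂ V) :
    Module.End ℂ V →ₗ[ℂ] Module.End ℂ V :=
  LinearMap.mulLeft ℂ f - LinearMap.mulRight ℂ f

/-- The diagonal `𝔤`-action of the basis vector `X_l` on `End V ⊗ S(𝔤)`. -/
def Dact {n : ℕ} (c : Fin n → Fin n → Fin n → ℂ) {V : Type*} [AddCommGroup V] [Module ℂ V]
    (τ : Fin n → Module.End ℂ V) (l : Fin n) :
    (Module.End ℂ V ⊗[ℂ] MvPolynomial (Fin n) ℂ) →ₗ[ℂ]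
      (Module.End ℂ V ⊗[ℂ] MvPolynomial (Fin n) ℂ) :=
  LinearMap.rTensor _ (adE (τ l)) + LinearMap.lTensor _ (Pb c (X l))

theorem Pb_apply {n : ℕ} (c : Fin n → Fin n → Fin n → ℂ) (a b : MvPolynomial (Fin n) ℂ) :
    Pb c a b = ∑ i, ∑ j, ∑ k, c k i j • (X k * pderiv i a * pderiv j b) := by
  simp [Pb, bil, LinearMap.sum_apply]

/-- The Hamiltonian derivation `b ↦ {a, b}`. -/
def hamiltonian {n : ℕ} (c : Fin n → Fin n → Fin n → ℂ) (a : MvPolynomial (Fin n) ℂ) :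
    Derivation ℂ (MvPolynomial (Fin n) ℂ) (MvPolynomial (Fin n) ℂ) :=
  ∑ i, ∑ j, ∑ k, (c k i j • (X k * pderiv i a)) • pderiv j

theorem hamiltonian_apply {n : ℕ} (c : Fin n → Fin n → Fin n → ℂ)
    (a b : MvPolynomial (Fin n) ℂ) : hamiltonian c a b = Pb c a b := by
  rw [Pb_apply, hamiltonian]
  simp only [← Derivation.coeFnAddMonoidHom_apply, map_sum, Finset.sum_apply]
  simp [Derivation.coeFnAddMonoidHom_apply]

theorem Pb_skew {n : ℕ} (c : Fin n → Fin n → Fin n → ℂ)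
    (hskew : ∀ k i j, c k i j = - c k j i) (a b : MvPolynomial (Fin n) ℂ) :
    Pb c a b = - Pb c b a := by
  rw [Pb_apply, Pb_apply, Finset.sum_comm]
  simp only [← Finset.sum_neg_distrib]
  refine Finset.sum_congr rfl fun i _ => Finset.sum_congr rfl fun j _ =>
    Finset.sum_congr rfl fun k _ => ?_
  rw [hskew k j i, neg_smul, mul_right_comm]

theorem Pb_X_X {n : ℕ} (c : Fin n → Fin n → Fin n → ℂ) (i j : Fin n) :
    Pb c (X i) (X j) = ∑ k, c k i j • X k := by
  rw [Pb_apply, Finset.sum_eq_single i, Finset.sum_eq_single j]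
  · simp
  · intro j' _ h
    simp [pderiv_X_of_ne h.symm]
  · simp
  · intro i' _ h
    simp [pderiv_X_of_ne h.symm]
  · simp

theorem Pb_X_X_X {n : ℕ} (c : Fin n → Fin n → Fin n → ℂ) (l i j : Fin n) :
    Pb c (X l) (Pb c (X i) (X j)) = ∑ m, (∑ k, c k i j * c m l k) • X m := by
  simp only [Pb_X_X, map_sum, map_smul, Finset.smul_sum, smul_smul, Finset.sum_smul]
  exact Finset.sum_comm

theorem Pb_jacobi_X {n : ℕ} (c : Fin n → Fin n → Fin n → ℂ)
    (hskew : ∀ k i j, c k i j = - c k j i)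
    (hjac : ∀ i j l m,
      (∑ k, (c k i j * c m k l + c k j l * c m k i + c k l i * c m k j)) = 0)
    (l i j : Fin n) :
    Pb c (X l) (Pb c (X i) (X j)) =
      Pb c (Pb c (X l) (X i)) (X j) + Pb c (X i) (Pb c (X l) (X j)) := by
  rw [Pb_skew c hskew (Pb c (X l) (X i)) (X j), Pb_X_X_X, Pb_X_X_X, Pb_X_X_X,
    ← Finset.sum_neg_distrib, ← Finset.sum_add_distrib]
  refine Finset.sum_congr rfl fun m _ => ?_
  rw [← neg_smul, ← add_smul]
  congr 1
  rw [← sub_eq_zero, ← neg_eq_zero, ← hjac i j l m, ← Finset.sum_neg_distrib,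
    ← Finset.sum_add_distrib, ← Finset.sum_sub_distrib, ← Finset.sum_neg_distrib]
  refine Finset.sum_congr rfl fun k _ => ?_
  rw [hskew m k l, hskew m k i, hskew m k j, hskew k j l]
  ring

/-- For fixed `p` and `a`, the Jacobi identity propagates from generators `X j` to all `b`. -/
theorem Pb_jacobi_of_X {n : ℕ} (c : Fin n → Fin n → Fin n → ℂ)
    (p a : MvPolynomial (Fin n) ℂ)
    (h : ∀ j, Pb c p (Pb c a (X j)) = Pb c (Pb c p a) (X j) + Pb c a (Pb c p (X j)))
    (b : MvPolynomial (Fin n) ℂ) :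
    Pb c p (Pb c a b) = Pb c (Pb c p a) b + Pb c a (Pb c p b) := by
  have key : ⁅hamiltonian c p, hamiltonian c a⁆ = hamiltonian c (Pb c p a) := by
    refine MvPolynomial.derivation_ext fun j => ?_
    simp only [Derivation.commutator_apply, hamiltonian_apply, h j]
    abel
  have := congrArg (fun D => D b) key
  simp only [Derivation.commutator_apply, hamiltonian_apply] at this
  rw [← this]
  abel

/-- `{X_l, ·}` is a derivation of the Poisson bracket. -/
theorem Pb_jacobi {n : ℕ} (c : Fin n → Fin n → Fin n → ℂ)
    (hskew : ∀ k i j, c k i j = - c k j i)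
    (hjac : ∀ i j l m,
      (∑ k, (c k i j * c m k l + c k j l * c m k i + c k l i * c m k j)) = 0)
    (l : Fin n) (a b : MvPolynomial (Fin n) ℂ) :
    Pb c (X l) (Pb c a b) = Pb c (Pb c (X l) a) b + Pb c a (Pb c (X l) b) := by
  refine Pb_jacobi_of_X c _ _ (fun j => ?_) b
  have h := Pb_jacobi_of_X c (X l) (X j) (Pb_jacobi_X c hskew hjac l j) a
  rw [Pb_skew c hskew a (X j), Pb_skew c hskew _ (X j), Pb_skew c hskew a, map_neg, h]
  abel

theorem adE_mul {V : Type*} [AddCommGroup V] [Module ℂ V] (f A B : Module.End ℂ V) :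
    adE f (A * B) = adE f A * B + A * adE f B := by
  simp only [adE, LinearMap.sub_apply, LinearMap.mulLeft_apply, LinearMap.mulRight_apply]
  noncomm_ring

theorem Dact_tmul {n : ℕ} (c : Fin n → Fin n → Fin n → ℂ) {V : Type*} [AddCommGroup V]
    [Module ℂ V] (τ : Fin n → Module.End ℂ V) (l : Fin n) (A : Module.End ℂ V)
    (a : MvPolynomial (Fin n) ℂ) :
    Dact c τ l (A ⊗ₜ a) = adE (τ l) A ⊗ₜ a + A ⊗ₜ Pb c (X l) a := by
  simp [Dact]

theorem Pnc_tmul {n : ℕ} (c : Fin n → Fin n → Fin n → ℂ) {V : Type*} [AddCommGroup V]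
    [Module ℂ V] (A B : Module.End ℂ V) (a b : MvPolynomial (Fin n) ℂ) :
    Pnc c V (A ⊗ₜ a) (B ⊗ₜ b) = (A * B) ⊗ₜ Pb c a b := by
  simp [Pnc]

/-- The diagonal action is by derivations of the noncommutative Poisson bracket. -/
theorem Dact_Pnc {n : ℕ} (c : Fin n → Fin n → Fin n → ℂ)
    {V : Type*} [AddCommGroup V] [Module ℂ V] (τ : Fin n → Module.End ℂ V)
    (hskew : ∀ k i j, c k i j = - c k j i)
    (hjac : ∀ i j l m,
      (∑ k, (c k i j * c m k l + c k j l * c m k i + c k l i * c m k j)) = 0)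
    (l : Fin n) (𝒜 ℬ : Module.End ℂ V ⊗[ℂ] MvPolynomial (Fin n) ℂ) :
    Dact c τ l (Pnc c V 𝒜 ℬ) = Pnc c V (Dact c τ l 𝒜) ℬ + Pnc c V 𝒜 (Dact c τ l ℬ) := by
  induction 𝒜 using TensorProduct.induction_on with
  | zero => simp
  | add x y hx hy =>
    simp only [map_add, LinearMap.add_apply, hx, hy]
    abel
  | tmul A a =>
    induction ℬ using TensorProduct.induction_on with
    | zero => simp
    | add x y hx hy =>
      simp only [map_add, hx, hy]
      abel
    | tmul B b =>
      simp only [Pnc_tmul, Dact_tmul, map_add, LinearMap.add_apply, adE_mul,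
        Pb_jacobi c hskew hjac, add_tmul, tmul_add]
      abel

/-- the classical family algebra is closed under the noncommutative
Poisson bracket. -/
theorem stmt7 {n : ℕ} (c : Fin n → Fin n → Fin n → ℂ)
    {V : Type*} [AddCommGroup V] [Module ℂ V] (τ : Fin n → Module.End ℂ V)
    (hskew : ∀ k i j, c k i j = - c k j i)
    (hjac : ∀ i j l m, (∑ k, (c k i j * c m k l + c k j l * c m k i + c k l i * c m k j)) = 0)
    (hτ : ∀ i j, τ i * τ j - τ j * τ i = ∑ k, c k i j • τ k)
    (𝒜 ℬ : Module.End ℂ V ⊗[ℂ] MvPolynomial (Fin n) ℂ)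
    (h𝒜 : ∀ l, Dact c τ l 𝒜 = 0) (hℬ : ∀ l, Dact c τ l ℬ = 0) :
    ∀ l, Dact c τ l (Pnc c V 𝒜 ℬ) = 0 := by
  intro l
  rw [Dact_Pnc c τ hskew hjac, h𝒜, hℬ]
  simp

end
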